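/- Let d ≥ 1 and 1 ≤ k ≤ d with 2k ≠ d. Then Σ_{Q ∈ Sym⁺(2,d)} ( Σ_{μ} det(Q_{μ,μ}) )² = 2^{d−1} · d!, where the inner sum runs over all k-combinations μ of {0,…,d−1}; that is, the sum over the group of the squared trace of the k-th compound matrix φ_k(Q) equals the order of the group. -/

import Mathlib

open Classical

/-- A `d × d` real signed permutation matrix: entries in `{0, 1, -1}`, with exactly one
nonzero entry in each row and each column. -/
def IsSignedPerm {d : ℕ} (Q : Matrix (Fin d) (Fin d) ℝ) : Prop :=
  (∀ i j, Q i j = 0 ∨ Q i j = 1 ∨ Q i j = -1) ∧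
  (∀ i, ∃! j, Q i j ≠ 0) ∧ (∀ j, ∃! i, Q i j ≠ 0)

namespace SignedPerm

variable {d k : ℕ}

/-- The matrix whose row `i` has the entry `ε i` in column `π i` and zeros elsewhere. -/
def toMatrix (p : (Fin d → ℤˣ) × Equiv.Perm (Fin d)) : Matrix (Fin d) (Fin d) ℝ :=
  Matrix.of fun i j => if p.2 i = j then ((p.1 i : ℤ) : ℝ) else 0

lemma toMatrix_apply (p : (Fin d → ℤˣ) × Equiv.Perm (Fin d)) (i j : Fin d) :
    toMatrix p i j = if p.2 i = j then ((p.1 i : ℤ) : ℝ) else 0 := rfl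

lemma cast_unit_ne_zero (u : ℤˣ) : ((u : ℤ) : ℝ) ≠ 0 := by
  rcases Int.units_eq_one_or u with h | h <;> simp [h]

lemma cast_unit_mul_self (u : ℤˣ) : ((u : ℤ) : ℝ) * ((u : ℤ) : ℝ) = 1 := by
  rcases Int.units_eq_one_or u with h | h <;> simp [h]

lemma toMatrix_ne_zero_iff (p : (Fin d → ℤˣ) × Equiv.Perm (Fin d)) (i j : Fin d) :
    toMatrix p i j ≠ 0 ↔ p.2 i = j := by
  simp [toMatrix_apply]

lemma toMatrix_injective :
    Function.Injective (toMatrix : (Fin d → ℤˣ) × Equiv.Perm (Fin d) → _) := by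
  intro p q h
  have hperm : p.2 = q.2 := by
    ext1 i
    have := (toMatrix_ne_zero_iff p i (p.2 i)).2 rfl
    rw [h, toMatrix_ne_zero_iff] at this
    exact this.symm
  refine Prod.ext (funext fun i => ?_) hperm
  have := congrFun (congrFun h i) (p.2 i)
  simp only [toMatrix_apply, hperm, if_true] at this
  exact Units.ext (by exact_mod_cast this)

lemma isSignedPerm_toMatrix (p : (Fin d → ℤˣ) × Equiv.Perm (Fin d)) :
    IsSignedPerm (toMatrix p) := by
  refine ⟨fun i j => ?_, fun i => ⟨p.2 i, ?_, ?_⟩, fun j => ⟨p.2.symm j, ?_, ?_⟩⟩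
  · rw [toMatrix_apply]
    split_ifs
    · rcases Int.units_eq_one_or (p.1 i) with h | h <;> simp [h]
    · exact Or.inl rfl
  · exact (toMatrix_ne_zero_iff p _ _).2 rfl
  · exact fun j hj => ((toMatrix_ne_zero_iff p _ _).1 hj).symm
  · exact (toMatrix_ne_zero_iff p _ _).2 (p.2.apply_symm_apply j)
  · exact fun i hi => (p.2.symm_apply_eq.2 ((toMatrix_ne_zero_iff p _ _).1 hi).symm).symm

lemma exists_toMatrix_eq {Q : Matrix (Fin d) (Fin d) ℝ} (hQ : IsSignedPerm Q) :
    ∃ p, toMatrix p = Q := by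
  obtain ⟨hent, hrow, hcol⟩ := hQ
  choose f hf huniq using hrow
  have hinj : Function.Injective f := fun a b hab =>
    (hcol (f a)).unique (hf a) (by simpa only [hab] using hf b)
  refine ⟨(fun i => if Q i (f i) = 1 then 1 else -1,
    Equiv.ofBijective f (Finite.injective_iff_bijective.1 hinj)), ?_⟩
  ext i j
  rw [toMatrix_apply]
  simp only [Equiv.ofBijective_apply]
  by_cases hij : f i = j
  · subst hij
    rcases hent i (f i) with h | h | h
    · exact absurd h (hf i)
    · simp [h]
    · simp [h]; norm_num
  · rw [if_neg hij]
    by_contra h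
    exact hij (huniq i j (Ne.symm h)).symm

/-- The minor of `toMatrix p` on the rows `μ` and the columns `ν`. -/
noncomputable def minor (μ ν : Fin k → Fin d) (p : (Fin d → ℤˣ) × Equiv.Perm (Fin d)) : ℝ :=
  ((toMatrix p).submatrix μ ν).det

lemma minor_mul_left (μ ν : Fin k → Fin d) (δ : Fin d → ℤˣ)
    (p : (Fin d → ℤˣ) × Equiv.Perm (Fin d)) :
    minor μ ν (δ * p.1, p.2) = (((∏ i, δ (μ i) : ℤˣ) : ℤ) : ℝ) * minor μ ν p := by
  have h : (toMatrix (δ * p.1, p.2)).submatrix μ ν =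
      Matrix.of fun i j => ((δ (μ i) : ℤ) : ℝ) * (toMatrix p).submatrix μ ν i j := by
    ext i j
    simp [toMatrix_apply]
  rw [minor, h, Matrix.det_mul_column, minor]
  push_cast
  rfl

lemma minor_inv_mul (μ ν : Fin k → Fin d) (ε : Fin d → ℤˣ) (σ π : Equiv.Perm (Fin d)) :
    minor μ ν (ε, σ⁻¹ * π) = minor μ (σ ∘ ν) (ε, π) := by
  unfold minor
  congr 1
  ext i j
  simp [toMatrix_apply, Equiv.symm_apply_eq]

lemma det_toMatrix (p : (Fin d → ℤˣ) × Equiv.Perm (Fin d)) :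
    (toMatrix p).det = (((∏ i, p.1 i) * Equiv.Perm.sign p.2 : ℤˣ) : ℤ) := by
  have h : toMatrix p =
      Matrix.of fun i j => ((p.1 i : ℤ) : ℝ) * Equiv.Perm.permMatrix ℝ p.2 i j := by
    ext i j
    simp [toMatrix_apply, PEquiv.toMatrix_apply, eq_comm]
  rw [h, Matrix.det_mul_column, Matrix.det_permutation]
  push_cast
  rfl

lemma sq_minor (μ ν : Fin k → Fin d) (hμ : μ.Injective) (hν : ν.Injective)
    (p : (Fin d → ℤˣ) × Equiv.Perm (Fin d)) :
    minor μ ν p ^ 2 = if ∀ i, p.2 (μ i) ∈ Set.range ν then 1 else 0 := by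
  split_ifs with h
  · have hM : (toMatrix p).submatrix μ ν * ((toMatrix p).submatrix μ ν).transpose = 1 := by
      ext i i'
      obtain ⟨j, hj⟩ := h i
      rw [Matrix.mul_apply, Finset.sum_eq_single j]
      · by_cases hi : i = i'
        · subst hi
          simp [toMatrix_apply, hj, cast_unit_mul_self]
        · have : p.2 (μ i') ≠ ν j := by
            rw [hj]
            exact fun h' => hi (hμ (p.2.injective h')).symm
          simp [toMatrix_apply, this, Matrix.one_apply_ne hi]
      · intro j' _ hj'
        have : p.2 (μ i) ≠ ν j' := by
          rw [← hj]
          exact fun h' => hj' (hν h').symm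
        simp [toMatrix_apply, this]
      · simp
    have := congrArg Matrix.det hM
    rwa [Matrix.det_mul, Matrix.det_transpose, Matrix.det_one, ← sq] at this
  · push Not at h
    obtain ⟨i, hi⟩ := h
    rw [minor, Matrix.det_eq_zero_of_row_eq_zero i, zero_pow two_ne_zero]
    intro j
    have : p.2 (μ i) ≠ ν j := fun h' => hi ⟨j, h'.symm⟩
    simp [toMatrix_apply, this]

lemma sum_sq_minor (μ : Fin k → Fin d) (hμ : μ.Injective)
    (p : (Fin d → ℤˣ) × Equiv.Perm (Fin d)) :
    ∑ ν : {f : Fin k → Fin d // StrictMono f}, minor μ ν.1 p ^ 2 = 1 := by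
  set s : Finset (Fin d) := Finset.univ.image (p.2 ∘ μ) with hs
  have hcard : s.card = k := by
    rw [hs, Finset.card_image_of_injective _ (p.2.injective.comp hμ), Finset.card_fin]
  rw [Fintype.sum_eq_single ⟨s.orderEmbOfFin hcard, (s.orderEmbOfFin hcard).strictMono⟩]
  · rw [sq_minor μ _ hμ (s.orderEmbOfFin hcard).injective, if_pos]
    intro i
    rw [Finset.range_orderEmbOfFin]
    simp [hs]
  · intro ν hne
    rw [sq_minor μ _ hμ ν.2.injective, if_neg]
    intro h
    refine hne (Subtype.ext (Finset.orderEmbOfFin_unique hcard (fun x => ?_) ν.2))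
    have hsub : s ⊆ Finset.univ.image ν.1 := by
      intro a ha
      simp only [hs, Finset.mem_image, Finset.mem_univ, true_and, Function.comp_apply] at ha ⊢
      obtain ⟨i, rfl⟩ := ha
      exact h i
    rw [Finset.eq_of_subset_of_card_le hsub (Finset.card_image_le.trans (by simp [hcard]))]
    exact Finset.mem_image_of_mem _ (Finset.mem_univ x)

/-- The pairs of signs and permutation whose signed permutation matrix has determinant `1`. -/
noncomputable def detOne (d : ℕ) : Finset ((Fin d → ℤˣ) × Equiv.Perm (Fin d)) :=
  Finset.univ.filter fun p => (∏ i, p.1 i) * Equiv.Perm.sign p.2 = 1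

lemma mem_detOne {p : (Fin d → ℤˣ) × Equiv.Perm (Fin d)} :
    p ∈ detOne d ↔ (∏ i, p.1 i) * Equiv.Perm.sign p.2 = 1 := by
  simp [detOne]

lemma sum_detOne_translate (f : (Fin d → ℤˣ) × Equiv.Perm (Fin d) → ℝ) (δ : Fin d → ℤˣ)
    (σ : Equiv.Perm (Fin d)) (h : ∏ i, δ i = Equiv.Perm.sign σ) :
    ∑ p ∈ detOne d, f (δ * p.1, σ⁻¹ * p.2) = ∑ p ∈ detOne d, f p := by
  refine Finset.sum_equiv ((Equiv.mulLeft δ).prodCongr (Equiv.mulLeft σ⁻¹)) (fun p => ?_)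
    (fun p _ => rfl)
  rw [mem_detOne, mem_detOne]
  simp only [Equiv.prodCongr_apply, Prod.map, Equiv.coe_mulLeft, Pi.mul_apply,
    Finset.prod_mul_distrib, h, map_mul, Equiv.Perm.sign_inv]
  rw [mul_mul_mul_comm, Int.units_mul_self, one_mul]

lemma card_detOne (hd : 1 ≤ d) : (detOne d).card = 2 ^ (d - 1) * d.factorial := by
  set δ : Fin d → ℤˣ := Pi.mulSingle ⟨0, hd⟩ (-1) with hδ
  have hprod : ∏ i, δ i = -1 := by simp [hδ]
  have hcompl : (detOne d).card = (detOne d)ᶜ.card := by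
    refine Finset.card_equiv ((Equiv.mulLeft δ).prodCongr (Equiv.refl _)) (fun p => ?_)
    rw [Finset.mem_compl, mem_detOne, mem_detOne]
    simp only [Equiv.prodCongr_apply, Prod.map, Equiv.coe_mulLeft, Pi.mul_apply,
      Finset.prod_mul_distrib, hprod, Equiv.refl_apply]
    rcases Int.units_eq_one_or ((∏ i, p.1 i) * Equiv.Perm.sign p.2) with h | h <;>
      simp [h]
  have htot := Finset.card_add_card_compl (detOne d)
  rw [← hcompl, Fintype.card_prod, Fintype.card_fun, Fintype.card_perm, Fintype.card_fin,
    Fintype.card_units_int] at htot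
  obtain ⟨e, rfl⟩ : ∃ e, d = e + 1 := ⟨d - 1, by omega⟩
  rw [pow_succ, mul_right_comm] at htot
  rw [Nat.add_sub_cancel]
  omega

lemma sum_detOne_sq_minor_eq (hd : 1 ≤ d) (μ ν : Fin k → Fin d) (hμ : μ.Injective)
    (hν : ν.Injective) :
    ∑ p ∈ detOne d, minor μ ν p ^ 2 = ∑ p ∈ detOne d, minor μ μ p ^ 2 := by
  obtain ⟨σ, hσ⟩ := Equiv.Perm.exists_extending_pair ν μ hν hμ
  rw [← sum_detOne_translate _ (Pi.mulSingle ⟨0, hd⟩ (Equiv.Perm.sign σ)) σ (by simp)]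
  refine Finset.sum_congr rfl fun p _ => ?_
  rw [minor_inv_mul, show σ ∘ ν = μ from funext hσ, minor_mul_left, mul_pow, sq (Int.cast _),
    cast_unit_mul_self, one_mul]

lemma sum_sum_sq_minor (hd : 1 ≤ d) (hkd : k ≤ d) :
    ∑ μ : {f : Fin k → Fin d // StrictMono f}, ∑ p ∈ detOne d, minor μ.1 μ.1 p ^ 2 =
      2 ^ (d - 1) * d.factorial := by
  have : Nonempty {f : Fin k → Fin d // StrictMono f} :=
    ⟨⟨Fin.castLE hkd, Fin.strictMono_castLE hkd⟩⟩
  have hdouble : ∑ μ : {f : Fin k → Fin d // StrictMono f},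
      ∑ ν : {f : Fin k → Fin d // StrictMono f}, ∑ p ∈ detOne d, minor μ.1 ν.1 p ^ 2 =
      Fintype.card {f : Fin k → Fin d // StrictMono f} * (2 ^ (d - 1) * d.factorial : ℝ) := by
    rw [Finset.sum_congr rfl fun μ _ => Finset.sum_comm]
    simp_rw [fun μ : {f : Fin k → Fin d // StrictMono f} => sum_sq_minor μ.1 μ.2.injective]
    simp [card_detOne hd]
  simp_rw [fun μ ν : {f : Fin k → Fin d // StrictMono f} =>
    sum_detOne_sq_minor_eq hd μ.1 ν.1 μ.2.injective ν.2.injective] at hdouble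
  rw [Finset.sum_congr rfl fun μ _ => Finset.sum_const _, ← Finset.smul_sum, nsmul_eq_mul,
    Finset.card_univ] at hdouble
  exact mul_left_cancel₀ (Nat.cast_ne_zero.2 Fintype.card_ne_zero) hdouble

/-- A sign vector of product `1` separating two `k`-subsets that are neither equal nor
complementary. -/
lemma exists_sign_separating (h2k : 2 * k ≠ d) {μ ν : Fin k → Fin d} (hμ : StrictMono μ)
    (hν : StrictMono ν) (hne : μ ≠ ν) :
    ∃ δ : Fin d → ℤˣ, ∏ i, δ i = 1 ∧ (∏ i, δ (μ i)) * ∏ i, δ (ν i) = -1 := by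
  set A := Finset.univ.image μ with hA
  set B := Finset.univ.image ν with hB
  have hAc : A.card = k := by
    rw [hA, Finset.card_image_of_injective _ hμ.injective, Finset.card_fin]
  have hBc : B.card = k := by
    rw [hB, Finset.card_image_of_injective _ hν.injective, Finset.card_fin]
  have hprod (κ : Fin k → Fin d) (hκ : κ.Injective) (δ : Fin d → ℤˣ) :
      ∏ i, δ (κ i) = ∏ a ∈ Finset.univ.image κ, δ a := by
    rw [Finset.prod_image hκ.injOn]
  obtain ⟨x, hx⟩ : ∃ x, ¬(x ∈ A ↔ x ∈ B) := by
    by_contra! h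
    have hAB : A = B := Finset.ext h
    refine hne ((hμ.range_inj hν).1 ?_)
    simpa [hA, hB] using congrArg (fun s : Finset (Fin d) => (s : Set (Fin d))) hAB
  obtain ⟨y, hy⟩ : ∃ y, y ∈ A ↔ y ∈ B := by
    by_contra! h
    have hAB : B = Aᶜ := by
      ext a
      rw [Finset.mem_compl]
      have := h a
      tauto
    have := Finset.card_add_card_compl A
    rw [← hAB, hAc, hBc, Fintype.card_fin] at this
    omega
  refine ⟨Pi.mulSingle x (-1) * Pi.mulSingle y (-1), ?_, ?_⟩
  · simp [Finset.prod_mul_distrib]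
  · rw [hprod μ hμ.injective, hprod ν hν.injective, ← hA, ← hB]
    simp only [Pi.mul_apply, Finset.prod_mul_distrib, Finset.prod_pi_mulSingle']
    by_cases h1 : x ∈ A <;> by_cases h2 : x ∈ B <;> by_cases h3 : y ∈ A <;>
      by_cases h4 : y ∈ B <;> simp_all

lemma sum_minor_mul_minor_eq_zero (h2k : 2 * k ≠ d) {μ ν : Fin k → Fin d} (hμ : StrictMono μ)
    (hν : StrictMono ν) (hne : μ ≠ ν) :
    ∑ p ∈ detOne d, minor μ μ p * minor ν ν p = 0 := by
  obtain ⟨δ, hδ, hsep⟩ := exists_sign_separating h2k hμ hν hne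
  have hneg : ∑ p ∈ detOne d, minor μ μ p * minor ν ν p =
      -∑ p ∈ detOne d, minor μ μ p * minor ν ν p := by
    conv_lhs => rw [← sum_detOne_translate _ δ 1 (by simpa using hδ)]
    rw [← Finset.sum_neg_distrib]
    refine Finset.sum_congr rfl fun p _ => ?_
    rw [inv_one, one_mul, minor_mul_left, minor_mul_left, mul_mul_mul_comm, ← Int.cast_mul,
      ← Units.val_mul, hsep]
    simp
  linarith

end SignedPerm

/-- Let `S = Sym⁺(2,d)` be the set of `d × d` signed permutation matrices with
determinant `1`, and let `1 ≤ k ≤ d` with `2k ≠ d`. Then the sum over `S` of the squared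
trace of the `k`-th compound matrix, `∑_{Q ∈ S} (∑_μ det (Q_{μ,μ}))²`, where `μ` runs over
all `k`-combinations (strictly increasing tuples), equals `2^{d-1} · d!`, the order of the
group. -/
theorem signedPerm_compound_character_norm
    (d k : ℕ) (hd : 1 ≤ d) (hk : 1 ≤ k) (hkd : k ≤ d) (h2k : 2*k ≠ d)
    (S : Finset (Matrix (Fin d) (Fin d) ℝ))
    (hS : ∀ Q, Q ∈ S ↔ IsSignedPerm Q ∧ Q.det = 1) :
    ∑ Q ∈ S, (∑ μ : {f : Fin k → Fin d // StrictMono f}, (Q.submatrix μ.1 μ.1).det) ^ 2 =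
      (2 ^ (d-1) * d.factorial : ℝ) := by
  have hSimage : S = (SignedPerm.detOne d).image SignedPerm.toMatrix := by
    ext Q
    rw [hS, Finset.mem_image]
    constructor
    · rintro ⟨hQ, hdet⟩
      obtain ⟨p, rfl⟩ := SignedPerm.exists_toMatrix_eq hQ
      rw [SignedPerm.det_toMatrix] at hdet
      exact ⟨p, SignedPerm.mem_detOne.2 (Units.ext (Int.cast_injective (α := ℝ) (hdet.trans (by simp)))), rfl⟩
    · rintro ⟨p, hp, rfl⟩
      refine ⟨SignedPerm.isSignedPerm_toMatrix p, ?_⟩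
      rw [SignedPerm.det_toMatrix, SignedPerm.mem_detOne.1 hp]
      simp
  rw [hSimage, Finset.sum_image SignedPerm.toMatrix_injective.injOn,
    ← SignedPerm.sum_sum_sq_minor hd hkd]
  change ∑ p ∈ SignedPerm.detOne d, (∑ μ : {f : Fin k → Fin d // StrictMono f},
    SignedPerm.minor μ.1 μ.1 p) ^ 2 = _
  simp_rw [sq (∑ μ : {f : Fin k → Fin d // StrictMono f}, _), Finset.sum_mul_sum]
  rw [Finset.sum_comm]
  refine Finset.sum_congr rfl fun μ _ => ?_
  rw [Finset.sum_comm, Fintype.sum_eq_single μ]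
  · simp_rw [sq]
  · exact fun ν hν => SignedPerm.sum_minor_mul_minor_eq_zero h2k μ.2 ν.2
      fun h => hν (Subtype.ext h.symm)
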